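/- For every real number α > 2, the function g(ζ) := ζ^{2/α} ∫_{ζ^{−2/α}}^∞ (1 + u^{α/2})^{−1} du is strictly increasing on (0, ∞); consequently, for any p > 0 and integer k ≥ 1, the SIR complementary CDF ζ ↦ (1 + p · g(ζ))^{−k} of equation (26) of the paper is strictly decreasing on (0, ∞). -/

import Mathlib

open MeasureTheory Real Set

lemma aux_int (s : ℝ) (hs : 1 < s) (c : ℝ) (hc : 0 < c) :
    IntegrableOn (fun u : ℝ => (1 + u ^ s)⁻¹) (Set.Ioi c) := by
  have h := integrableOn_Ioi_rpow_of_lt (a := -s) (by linarith) hc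
  refine Integrable.mono' h ?_ ?_
  · exact (by fun_prop : Measurable (fun u : ℝ => (1 + u ^ s)⁻¹)).aestronglyMeasurable
  · refine (ae_restrict_iff' measurableSet_Ioi).2 (Filter.Eventually.of_forall fun u hu => ?_)
    have hu0 : 0 < u := lt_trans hc hu
    have h1 : 0 < u ^ s := Real.rpow_pos_of_pos hu0 s
    rw [Real.norm_of_nonneg (by positivity), Real.rpow_neg hu0.le]
    exact inv_anti₀ h1 (by linarith)

lemma aux_pos (s : ℝ) (hs : 1 < s) (c : ℝ) (hc : 0 < c) :
    0 < ∫ u in Set.Ioi c, (1 + u ^ s)⁻¹ := by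
  have hp : ∀ u ∈ Set.Ioi c, 0 < (1 + u ^ s)⁻¹ := fun u hu => by
    have hu0 : 0 < u := lt_trans hc hu
    have h1 : 0 < u ^ s := Real.rpow_pos_of_pos hu0 s
    positivity
  rw [setIntegral_pos_iff_support_of_nonneg_ae _ (aux_int s hs c hc)]
  · have : Function.support (fun u : ℝ => (1 + u ^ s)⁻¹) ∩ Set.Ioi c = Set.Ioi c :=
      Set.inter_eq_right.2 fun u hu => (hp u hu).ne'
    rw [this]; simp
  · exact (ae_restrict_iff' measurableSet_Ioi).2
      (Filter.Eventually.of_forall fun u hu => (hp u hu).le)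

lemma aux_mono (s : ℝ) (hs : 1 < s) (c d : ℝ) (hc : 0 < c) (hcd : c ≤ d) :
    ∫ u in Set.Ioi d, (1 + u ^ s)⁻¹ ≤ ∫ u in Set.Ioi c, (1 + u ^ s)⁻¹ := by
  refine setIntegral_mono_set (aux_int s hs c hc) ?_ (Set.Ioi_subset_Ioi hcd).eventuallyLE
  refine (ae_restrict_iff' measurableSet_Ioi).2 (Filter.Eventually.of_forall fun u hu => ?_)
  have hu0 : 0 < u := lt_trans hc hu
  have h1 : 0 < u ^ s := Real.rpow_pos_of_pos hu0 s
  show 0 ≤ (1 + u ^ s)⁻¹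
  positivity

/-- For `α > 2`, `g(ζ) = ζ^{2/α} ∫_{ζ^{−2/α}}^∞ (1+u^{α/2})⁻¹ du` is strictly
increasing on `(0,∞)`; consequently the SIR complementary CDF
`ζ ↦ (1 + p·g(ζ))^{−k}` of equation (26) is strictly decreasing on `(0,∞)`. -/
theorem stmt_9 (α : ℝ) (hα : 2 < α) (p : ℝ) (hp : 0 < p) (k : ℕ) (hk : 1 ≤ k) :
    StrictMonoOn (fun ζ : ℝ =>
        ζ ^ (2 / α) * ∫ u in Set.Ioi (ζ ^ (-(2 / α))), (1 + u ^ (α / 2))⁻¹) (Set.Ioi 0)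
    ∧ StrictAntiOn (fun ζ : ℝ =>
        ((1 + p * (ζ ^ (2 / α) * ∫ u in Set.Ioi (ζ ^ (-(2 / α))), (1 + u ^ (α / 2))⁻¹)) ^ k)⁻¹)
        (Set.Ioi 0) := by
  have hs : 1 < α / 2 := by linarith
  have ht : 0 < 2 / α := by positivity
  have hI : ∀ ζ : ℝ, 0 < ζ → 0 < ∫ u in Set.Ioi (ζ ^ (-(2 / α))), (1 + u ^ (α / 2))⁻¹ :=
    fun ζ h => aux_pos _ hs _ (Real.rpow_pos_of_pos h _)
  have key : StrictMonoOn (fun ζ : ℝ =>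
        ζ ^ (2 / α) * ∫ u in Set.Ioi (ζ ^ (-(2 / α))), (1 + u ^ (α / 2))⁻¹) (Set.Ioi 0) := by
    intro x hx y hy hxy
    have hx0 : 0 < x := hx
    have hy0 : 0 < y := hy
    refine mul_lt_mul (Real.rpow_lt_rpow hx0.le hxy ht) ?_ (hI x hx0)
      (Real.rpow_pos_of_pos hy0 _).le
    exact aux_mono _ hs _ _ (Real.rpow_pos_of_pos hy0 _)
      (Real.rpow_le_rpow_of_nonpos hx0 hxy.le (by linarith))
  refine ⟨key, fun x hx y hy hxy => ?_⟩
  have h := key hx hy hxy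
  have hx0 : 0 < x := hx
  have h0 := mul_pos (Real.rpow_pos_of_pos hx0 (2 / α)) (hI x hx0)
  have h1 := mul_pos hp h0
  have h2 := mul_lt_mul_of_pos_left h hp
  refine inv_strictAnti₀ (pow_pos (by linarith) k) ?_
  exact pow_lt_pow_left₀ (by simpa using h2) (by linarith) (by omega)
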